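/- arXiv:1208.2971 — 9 statements merged into one kernel-verified Lean document; each statement's English description precedes it below -/
import Mathlib

section
/- In the logic Int2GC, the Fischer Servi axiom schemes (FS1) and (FS4) are deductively equivalent: the smallest extension of Int2GC containing all instances of (FS1) ◆(A → B) → (■A → ◆B) and the smallest extension of Int2GC containing all instances of (FS4) (◇A → □B) → □(A → B) prove exactly the same formulas. -/
/-- Formulas of the modal language with four unary modalities:
`dia1` = ◆, `box1` = □, `dia2` = ◇, `box2` = ■. -/
inductive Fm : Type
  | var : ℕ → Fm
  | and : Fm → Fm → Fm
  | or  : Fm → Fm → Fm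
  | imp : Fm → Fm → Fm
  | neg : Fm → Fm
  | dia1 : Fm → Fm
  | box1 : Fm → Fm
  | dia2 : Fm → Fm
  | box2 : Fm → Fm

/-- Instances of the axiom schemes of intuitionistic propositional logic. -/
inductive IntAx : Fm → Prop
  | a1 (A B : Fm) : IntAx (.imp A (.imp B A))
  | a2 (A B C : Fm) : IntAx (.imp (.imp A (.imp B C)) (.imp (.imp A B) (.imp A C)))
  | a3 (A B : Fm) : IntAx (.imp (.and A B) A)
  | a4 (A B : Fm) : IntAx (.imp (.and A B) B)
  | a5 (A B : Fm) : IntAx (.imp A (.imp B (.and A B)))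
  | a6 (A B : Fm) : IntAx (.imp A (.or A B))
  | a7 (A B : Fm) : IntAx (.imp B (.or A B))
  | a8 (A B C : Fm) : IntAx (.imp (.imp A C) (.imp (.imp B C) (.imp (.or A B) C)))
  | a9 (A B : Fm) : IntAx (.imp (.imp A B) (.imp (.imp A (.neg B)) (.neg A)))
  | a10 (A B : Fm) : IntAx (.imp (.neg A) (.imp A B))

/-- Provability in the extension of Int2GC by the extra axiom scheme `Ax`:
the smallest set of formulas containing all intuitionistic axiom instances and all
instances of `Ax`, closed under modus ponens and the four Galois-connection rules. -/
inductive Prov (Ax : Fm → Prop) : Fm → Prop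
  | intAx {A : Fm} : IntAx A → Prov Ax A
  | extra {A : Fm} : Ax A → Prov Ax A
  | mp {A B : Fm} : Prov Ax (.imp A B) → Prov Ax A → Prov Ax B
  | gc1 {A B : Fm} : Prov Ax (.imp A (.box1 B)) → Prov Ax (.imp (.dia1 A) B)
  | gc2 {A B : Fm} : Prov Ax (.imp (.dia1 A) B) → Prov Ax (.imp A (.box1 B))
  | gc3 {A B : Fm} : Prov Ax (.imp A (.box2 B)) → Prov Ax (.imp (.dia2 A) B)
  | gc4 {A B : Fm} : Prov Ax (.imp (.dia2 A) B) → Prov Ax (.imp A (.box2 B))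

/-- The empty extra axiom scheme: `Prov NoAx` is provability in Int2GC itself. -/
def NoAx : Fm → Prop := fun _ => False

/-- Instances of (FS1): ◆(A → B) → (■A → ◆B). -/
def FS1Ax (C : Fm) : Prop := ∃ A B : Fm, C = .imp (.dia1 (.imp A B)) (.imp (.box2 A) (.dia1 B))
/-- Instances of (FS2): ◇(A → B) → (□A → ◇B). -/
def FS2Ax (C : Fm) : Prop := ∃ A B : Fm, C = .imp (.dia2 (.imp A B)) (.imp (.box1 A) (.dia2 B))
/-- Instances of (FS3): (◆A → ■B) → ■(A → B). -/
def FS3Ax (C : Fm) : Prop := ∃ A B : Fm, C = .imp (.imp (.dia1 A) (.box2 B)) (.box2 (.imp A B))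
/-- Instances of (FS4): (◇A → □B) → □(A → B). -/
def FS4Ax (C : Fm) : Prop := ∃ A B : Fm, C = .imp (.imp (.dia2 A) (.box1 B)) (.box1 (.imp A B))
/-- The Fischer Servi scheme (FS1)+(FS2); `Prov FSAx` is provability in Int2GC+FS. -/
def FSAx (C : Fm) : Prop := FS1Ax C ∨ FS2Ax C

namespace Prov

variable {Ax Ax' : Fm → Prop} {A B C D : Fm}

theorem refl (A : Fm) : Prov Ax (.imp A A) :=
  mp (mp (intAx (.a2 A (.imp A A) A)) (intAx (.a1 _ _))) (intAx (.a1 _ _))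

theorem trans (h : Prov Ax (.imp A B)) (k : Prov Ax (.imp B C)) : Prov Ax (.imp A C) :=
  mp (mp (intAx (.a2 _ _ _)) (mp (intAx (.a1 _ _)) k)) h

theorem imp_mono_right (A : Fm) (h : Prov Ax (.imp B C)) :
    Prov Ax (.imp (.imp A B) (.imp A C)) :=
  mp (intAx (.a2 _ _ _)) (mp (intAx (.a1 _ _)) h)

theorem imp_mono_left (C : Fm) (h : Prov Ax (.imp A B)) :
    Prov Ax (.imp (.imp B C) (.imp A C)) :=
  mp (mp (intAx (.a2 _ _ _)) (trans (intAx (.a1 _ _)) (intAx (.a2 _ _ _))))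
    (mp (intAx (.a1 _ _)) h)

theorem imp_mono (h : Prov Ax (.imp A B)) (k : Prov Ax (.imp C D)) :
    Prov Ax (.imp (.imp B C) (.imp A D)) :=
  trans (imp_mono_left C h) (imp_mono_right A k)

/-- An extension of Int2GC proving every instance of `Ax` contains the extension by `Ax`. -/
theorem of_forall (h : ∀ A, Ax A → Prov Ax' A) (p : Prov Ax C) : Prov Ax' C := by
  induction p with
  | intAx a => exact intAx a
  | extra a => exact h _ a
  | mp _ _ ih₁ ih₂ => exact mp ih₁ ih₂
  | gc1 _ ih => exact gc1 ih
  | gc2 _ ih => exact gc2 ih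
  | gc3 _ ih => exact gc3 ih
  | gc4 _ ih => exact gc4 ih

theorem fs4_of_fs1 (h : FS4Ax C) : Prov FS1Ax C := by
  obtain ⟨A, B, rfl⟩ := h
  exact gc2 (trans (extra ⟨_, _, rfl⟩) (imp_mono (gc4 (refl _)) (gc1 (refl _))))

theorem fs1_of_fs4 (h : FS1Ax C) : Prov FS4Ax C := by
  obtain ⟨A, B, rfl⟩ := h
  exact gc1 (trans (imp_mono (gc3 (refl _)) (gc2 (refl _))) (extra ⟨_, _, rfl⟩))

end Prov

/-- In Int2GC, the Fischer Servi axiom schemes (FS1) and (FS4) are deductively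
equivalent: their extensions of Int2GC prove exactly the same formulas. -/
theorem FS1_equiv_FS4 : ∀ C : Fm, Prov FS1Ax C ↔ Prov FS4Ax C := by
  exact fun C =>
    ⟨Prov.of_forall fun _ => Prov.fs1_of_fs4, Prov.of_forall fun _ => Prov.fs4_of_fs1⟩
end

section
/- Let H be a Heyting algebra equipped with unary maps f, g, f', g' : H → H such that (f, g) and (f', g') are Galois connections. Then the following three conditions are equivalent: (fs1) for all a, b ∈ H, f (a ⇨ b) ≤ g' a ⇨ f b; (d1) for all a, b ∈ H, f a ⊓ g' b ≤ f (a ⊓ b); (fs4) for all a, b ∈ H, (f' a ⇨ g b) ≤ g (a ⇨ b). -/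
/-- For an H2GC-algebra (a Heyting algebra with Galois connections `(f, g)` and
`(f', g')`), the conditions (fs1), (d1) and (fs4) are equivalent. -/
theorem fs1_d1_fs4_equiv {H : Type*} [HeytingAlgebra H] (f g f' g' : H → H)
    (hfg : ∀ a b : H, f a ≤ b ↔ a ≤ g b) (hf'g' : ∀ a b : H, f' a ≤ b ↔ a ≤ g' b) :
    ((∀ a b : H, f (a ⇨ b) ≤ g' a ⇨ f b) ↔ (∀ a b : H, f a ⊓ g' b ≤ f (a ⊓ b)))
      ∧ ((∀ a b : H, f a ⊓ g' b ≤ f (a ⊓ b)) ↔ (∀ a b : H, (f' a ⇨ g b) ≤ g (a ⇨ b))) := by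
  have gc : GaloisConnection f g := hfg
  have gc' : GaloisConnection f' g' := hf'g'
  refine ⟨⟨fun h a b => ?_, fun h a b => ?_⟩, ⟨fun h a b => ?_, fun h a b => ?_⟩⟩
  · rw [← le_himp_iff]
    exact (gc.monotone_l (le_himp_iff.2 le_rfl)).trans (h b (a ⊓ b))
  · rw [le_himp_iff]
    exact (h (a ⇨ b) a).trans (gc.monotone_l himp_inf_le)
  · rw [← hfg, le_himp_iff]
    calc f (f' a ⇨ g b) ⊓ a ≤ f (f' a ⇨ g b) ⊓ g' (f' a) :=
          inf_le_inf_left _ (gc'.le_u_l a)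
      _ ≤ f ((f' a ⇨ g b) ⊓ f' a) := h _ _
      _ ≤ f (g b) := gc.monotone_l himp_inf_le
      _ ≤ b := gc.l_u_le b
  · rw [← le_himp_iff, hfg]
    refine le_trans (le_himp_iff.2 ?_) (h (g' b) (f (a ⊓ b)))
    exact (inf_le_inf_left a (gc'.l_u_le b)).trans (gc.le_u_l _)
end

section
/- Let H be a Heyting algebra equipped with unary maps f, g, f', g' : H → H such that (f, g) and (f', g') are Galois connections. Then the following three conditions are equivalent: (fs2) for all a, b ∈ H, f' (a ⇨ b) ≤ g a ⇨ f' b; (d2) for all a, b ∈ H, f' a ⊓ g b ≤ f' (a ⊓ b); (fs3) for all a, b ∈ H, (f a ⇨ g' b) ≤ g' (a ⇨ b). -/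
/-- For an H2GC-algebra (a Heyting algebra with Galois connections `(f, g)` and
`(f', g')`), the conditions (fs2), (d2) and (fs3) are equivalent. -/
theorem fs2_d2_fs3_equiv {H : Type*} [HeytingAlgebra H] (f g f' g' : H → H)
    (hfg : ∀ a b : H, f a ≤ b ↔ a ≤ g b) (hf'g' : ∀ a b : H, f' a ≤ b ↔ a ≤ g' b) :
    ((∀ a b : H, f' (a ⇨ b) ≤ g a ⇨ f' b) ↔ (∀ a b : H, f' a ⊓ g b ≤ f' (a ⊓ b)))
      ∧ ((∀ a b : H, f' a ⊓ g b ≤ f' (a ⊓ b)) ↔ (∀ a b : H, (f a ⇨ g' b) ≤ g' (a ⇨ b))) := by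
  have hf : GaloisConnection f g := hfg
  have hf' : GaloisConnection f' g' := hf'g'
  refine ⟨⟨fun h a b => ?_, fun h a b => ?_⟩, ⟨fun h a b => ?_, fun h a b => ?_⟩⟩
  · rw [← le_himp_iff]
    exact (hf'.monotone_l (le_himp_iff.2 le_rfl)).trans (h b (a ⊓ b))
  · rw [le_himp_iff]
    exact (h (a ⇨ b) a).trans (hf'.monotone_l himp_inf_le)
  · rw [← hf'g', le_himp_iff]
    calc f' (f a ⇨ g' b) ⊓ a ≤ f' (f a ⇨ g' b) ⊓ g (f a) :=
          inf_le_inf_left _ (hf.le_u_l a)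
      _ ≤ f' ((f a ⇨ g' b) ⊓ f a) := h _ _
      _ ≤ b := (hf'g' _ _).2 himp_inf_le
  · rw [← le_himp_iff, hf'g']
    refine le_trans (le_himp_iff.2 ?_) (h (g b) (f' (a ⊓ b)))
    exact (inf_le_inf_left a (hf.l_u_le b)).trans (hf'.le_u_l (a ⊓ b))
end

section
/- There exist a frame (complete Heyting algebra) H, a type U, a map R : U → U → H, and φ, ψ : U → H such that (φ ⊔ ψ)^■ ≰ φ^■ ⊔ ψ^◆ in the pointwise order. (One may take U a two-element type, H the five-element Heyting algebra with order 0 < a, b < c < 1 where a and b are incomparable, R symmetric with R(x,x) = a and R(x,y) = b for x ≠ y, φ constantly 0 and ψ constantly 1.) -/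
/-- Dunn's condition (D∨) fails in some algebra of rough lattice-valued fuzzy sets:
there exist a frame `H`, a type `U`, an `H`-fuzzy relation `R` and `H`-sets `φ, ψ`
with `(φ ⊔ ψ)^■ ≰ φ^■ ⊔ ψ^◆` in the pointwise order. -/
theorem not_dunn_dvee :
    ∃ (H : Type) (_ : Order.Frame H) (U : Type) (R : U → U → H) (φ ψ : U → H),
      ¬ (fun x => ⨅ y, R x y ⇨ (φ y ⊔ ψ y)) ≤
          ((fun x => ⨅ y, R x y ⇨ φ y) ⊔ (fun x => ⨆ y, R x y ⊓ ψ y)) := by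
  -- Over a one-point universe the condition is excluded middle, which the three-element chain lacks.
  refine ⟨Fin 3, inferInstance, Unit, fun _ _ => 1, fun _ => ⊥, fun _ => ⊤, fun h => ?_⟩
  have key := h ()
  simp only [Pi.sup_apply, ciInf_unique, ciSup_unique, sup_top_eq, himp_top, inf_top_eq,
    himp_bot] at key
  have hc : (1 : Fin 3)ᶜ = ⊥ := by
    have disj : (1 : Fin 3) ⊓ (1 : Fin 3)ᶜ = ⊥ := inf_compl_self _
    rcases min_choice (1 : Fin 3) (1 : Fin 3)ᶜ with e | e
    · exact absurd (e.symm.trans disj) (by decide)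
    · exact e.symm.trans disj
  rw [hc, bot_sup_eq] at key
  exact absurd key (by decide)
end

section
/- Let ≤ be a preorder on a set X and R a binary relation on X. Then R satisfies (R4) R ∘ ≤ ⊆ ≤ ∘ R and (R5) ≥ ∘ R ⊆ R ∘ ≥ if and only if the relations R₁ := R ∘ ≥ and R₂ := ≤ ∘ R satisfy (R2) ≥ ∘ R₁ ∘ ≥ ⊆ R₁ and (R3) ≤ ∘ R₂ ∘ ≤ ⊆ R₂. -/
/-- Relational composition: `x (S ∘ T) z` iff there is `y` with `x S y` and `y T z`. -/
def RelComp {X : Type*} (S T : X → X → Prop) : X → X → Prop := fun x z => ∃ y, S x y ∧ T y z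

/-- Inclusion of binary relations. -/
def RelSub {X : Type*} (S T : X → X → Prop) : Prop := ∀ x y, S x y → T x y

/-- `(X, ≤, R)` is an Int2GC+FS-frame (conditions (R4) and (R5)) iff
`(X, ≤, R ∘ ≥, ≤ ∘ R)` is an Int2GC-frame (conditions (R2) and (R3)). -/
theorem int2gcfs_frame_iff_int2gc_frame {X : Type*} [Preorder X] (R : X → X → Prop) :
    (RelSub (RelComp R (· ≤ ·)) (RelComp (· ≤ ·) R) ∧
        RelSub (RelComp (· ≥ ·) R) (RelComp R (· ≥ ·)))
      ↔
    (RelSub (RelComp (· ≥ ·) (RelComp (RelComp R (· ≥ ·)) (· ≥ ·))) (RelComp R (· ≥ ·)) ∧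
        RelSub (RelComp (· ≤ ·) (RelComp (RelComp (· ≤ ·) R) (· ≤ ·))) (RelComp (· ≤ ·) R)) := by
  constructor
  · rintro ⟨h4, h5⟩
    refine ⟨?_, ?_⟩
    · rintro x y ⟨a, hxa, c, ⟨b, hab, hbc⟩, hcy⟩
      obtain ⟨d, hxd, hdb⟩ := h5 x b ⟨a, hxa, hab⟩
      exact ⟨d, hxd, hcy.trans (hbc.trans hdb)⟩
    · rintro x y ⟨a, hxa, c, ⟨b, hab, hbc⟩, hcy⟩
      obtain ⟨d, hbd, hdy⟩ := h4 b y ⟨c, hbc, hcy⟩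
      exact ⟨d, hxa.trans (hab.trans hbd), hdy⟩
  · rintro ⟨h2, h3⟩
    refine ⟨?_, ?_⟩
    · rintro x y ⟨a, hxa, hay⟩
      exact h3 x y ⟨x, le_rfl, a, ⟨x, le_rfl, hxa⟩, hay⟩
    · rintro x y ⟨a, hxa, hay⟩
      exact h2 x y ⟨a, hxa, y, ⟨y, hay, le_rfl⟩, le_rfl⟩
end

section
/- Let ≤ be a preorder on a set X and R a binary relation on X. Then R satisfies (R4) R ∘ ≤ ⊆ ≤ ∘ R and (R5) ≥ ∘ R ⊆ R ∘ ≥ if and only if the relations S₁ := R ∘ ≥ and S₂ := R⁻¹ ∘ ≥ both satisfy the IntGC-frame condition, i.e. ≥ ∘ S₁ ∘ ≥ ⊆ S₁ and ≥ ∘ S₂ ∘ ≥ ⊆ S₂, where R⁻¹ is the converse relation (x R⁻¹ y iff y R x). -/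
/-- `(X, ≤, R)` is an Int2GC+FS-frame (conditions (R4) and (R5)) iff both
`(X, ≤, R ∘ ≥)` and `(X, ≤, R⁻¹ ∘ ≥)` are IntGC-frames, where `R⁻¹` is the converse. -/
theorem int2gcfs_frame_iff_two_intgc_frames {X : Type*} [Preorder X] (R : X → X → Prop) :
    (RelSub (RelComp R (· ≤ ·)) (RelComp (· ≤ ·) R) ∧
        RelSub (RelComp (· ≥ ·) R) (RelComp R (· ≥ ·)))
      ↔
    (RelSub (RelComp (· ≥ ·) (RelComp (RelComp R (· ≥ ·)) (· ≥ ·))) (RelComp R (· ≥ ·)) ∧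
        RelSub (RelComp (· ≥ ·) (RelComp (RelComp (fun x y => R y x) (· ≥ ·)) (· ≥ ·)))
          (RelComp (fun x y => R y x) (· ≥ ·))) := by
  constructor
  · rintro ⟨h4, h5⟩
    constructor
    · rintro x z ⟨a, hxa, c, ⟨b, hab, hbc⟩, hcz⟩
      obtain ⟨w, hxw, hwb⟩ := h5 x b ⟨a, hxa, hab⟩
      exact ⟨w, hxw, ge_trans hwb (ge_trans hbc hcz)⟩
    · rintro x z ⟨a, hxa, c, ⟨b, hba, hbc⟩, hcz⟩
      obtain ⟨w, hbw, hwx⟩ := h4 b x ⟨a, hba, hxa⟩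
      exact ⟨w, hwx, ge_trans hbw (ge_trans hbc hcz)⟩
  · rintro ⟨h1, h2⟩
    constructor
    · rintro x z ⟨y, hxy, hyz⟩
      obtain ⟨w, hwz, hwx⟩ := h2 z x ⟨y, hyz, x, ⟨x, hxy, le_rfl⟩, le_rfl⟩
      exact ⟨w, hwx, hwz⟩
    · rintro x z ⟨y, hxy, hyz⟩
      exact h1 x z ⟨y, hxy, z, ⟨z, hyz, le_rfl⟩, le_rfl⟩
end

section
/- Kripke soundness of Int2GC+FS: every formula provable in Int2GC+FS is satisfied at every point of every Kripke model on every Int2GC+FS-frame. -/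
/-- Satisfaction in a Kripke model on an Int2GC+FS-frame `(X, ≤, R)` with valuation `v`.
Here `x (R ∘ ≥) y` is rendered as `∃ z, R x z ∧ y ≤ z` and `x (≤ ∘ R) y` as
`∃ z, x ≤ z ∧ R z y`. -/
def SatFS {X : Type*} [Preorder X] (R : X → X → Prop) (v : ℕ → Set X) : X → Fm → Prop
  | x, .var n => x ∈ v n
  | x, .and A B => SatFS R v x A ∧ SatFS R v x B
  | x, .or A B => SatFS R v x A ∨ SatFS R v x B
  | x, .imp A B => ∀ y, x ≤ y → SatFS R v y A → SatFS R v y B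
  | x, .neg A => ∀ y, x ≤ y → ¬ SatFS R v y A
  | x, .dia1 A => ∃ y, (∃ z, R x z ∧ y ≤ z) ∧ SatFS R v y A
  | x, .box1 A => ∀ y, (∃ z, R y z ∧ x ≤ z) → SatFS R v y A
  | x, .dia2 A => ∃ y, (∃ z, y ≤ z ∧ R z x) ∧ SatFS R v y A
  | x, .box2 A => ∀ y, (∃ z, x ≤ z ∧ R z y) → SatFS R v y A

/-- Satisfaction persists along the preorder. -/
theorem SatFS.mono {X : Type*} [Preorder X] {R : X → X → Prop} {v : ℕ → Set X}
    (h₁ : ∀ x y z : X, R x y → y ≤ z → ∃ w, x ≤ w ∧ R w z)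
    (h₂ : ∀ x y z : X, y ≤ x → R y z → ∃ w, R x w ∧ z ≤ w)
    (hv : ∀ n, IsUpperSet (v n)) (A : Fm) {x y : X} (hxy : x ≤ y) (hx : SatFS R v x A) :
    SatFS R v y A := by
  induction A generalizing x y with
  | var n => exact hv n hxy hx
  | and A B ihA ihB => exact ⟨ihA hxy hx.1, ihB hxy hx.2⟩
  | or A B ihA ihB => exact hx.imp (ihA hxy) (ihB hxy)
  | imp A B => exact fun z hz => hx z (hxy.trans hz)
  | neg A => exact fun z hz => hx z (hxy.trans hz)
  | dia1 A =>
    obtain ⟨u, ⟨z, hxz, huz⟩, hu⟩ := hx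
    obtain ⟨w, hyw, hzw⟩ := h₂ y x z hxy hxz
    exact ⟨u, ⟨w, hyw, huz.trans hzw⟩, hu⟩
  | box1 A => exact fun u ⟨z, huz, hyz⟩ => hx u ⟨z, huz, hxy.trans hyz⟩
  | dia2 A =>
    obtain ⟨u, ⟨z, huz, hzx⟩, hu⟩ := hx
    obtain ⟨w, hzw, hwy⟩ := h₁ z x y hzx hxy
    exact ⟨u, ⟨w, huz.trans hzw, hwy⟩, hu⟩
  | box2 A => exact fun u ⟨z, hyz, hzu⟩ => hx u ⟨z, hxy.trans hyz, hzu⟩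

/-- The intuitionistic axioms hold wherever satisfaction is persistent. -/
theorem IntAx.satFS {X : Type*} [Preorder X] {R : X → X → Prop} {v : ℕ → Set X}
    (mono : ∀ (A : Fm) {x y : X}, x ≤ y → SatFS R v x A → SatFS R v y A)
    {A : Fm} (hA : IntAx A) (x : X) : SatFS R v x A := by
  cases hA with
  | a1 A B => exact fun y _ hA z hyz _ => mono A hyz hA
  | a2 A B C =>
    exact fun y _ hABC z hyz hAB w hzw hA =>
      hABC w (hyz.trans hzw) hA w le_rfl (hAB w hzw hA)
  | a3 A B => exact fun y _ h => h.1
  | a4 A B => exact fun y _ h => h.2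
  | a5 A B => exact fun y _ hA z hyz hB => ⟨mono A hyz hA, hB⟩
  | a6 A B => exact fun y _ h => Or.inl h
  | a7 A B => exact fun y _ h => Or.inr h
  | a8 A B C =>
    exact fun y _ hAC z hyz hBC w hzw h =>
      h.elim (hAC w (hyz.trans hzw)) (hBC w hzw)
  | a9 A B =>
    exact fun y _ hAB z hyz hAnB w hzw hA =>
      hAnB w hzw hA w le_rfl (hAB w (hyz.trans hzw) hA)
  | a10 A B => exact fun y _ hnA z hyz hA => (hnA z hyz hA).elim

/-- The Fischer Servi axioms hold in every model on an Int2GC+FS-frame. -/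
theorem FSAx.satFS {X : Type*} [Preorder X] {R : X → X → Prop} {v : ℕ → Set X}
    (h₁ : ∀ x y z : X, R x y → y ≤ z → ∃ w, x ≤ w ∧ R w z)
    (h₂ : ∀ x y z : X, y ≤ x → R y z → ∃ w, R x w ∧ z ≤ w)
    {A : Fm} (hA : FSAx A) (x : X) : SatFS R v x A := by
  rcases hA with ⟨A, B, rfl⟩ | ⟨A, B, rfl⟩
  · rintro y - ⟨u, ⟨z, hyz, huz⟩, hu⟩ y' hyy' hA
    obtain ⟨w, hyw, hzw⟩ := h₂ y' y z hyy' hyz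
    exact ⟨w, ⟨w, hyw, le_rfl⟩, hu w (huz.trans hzw) (hA w ⟨y', le_rfl, hyw⟩)⟩
  · rintro y - ⟨u, ⟨z, huz, hzy⟩, hu⟩ y' hyy' hA
    obtain ⟨w, hzw, hwy⟩ := h₁ z y y' hzy hyy'
    exact ⟨w, ⟨w, le_rfl, hwy⟩, hu w (huz.trans hzw) (hA w ⟨y', hwy, le_rfl⟩)⟩

/-- Kripke soundness of Int2GC+FS: every provable formula of Int2GC+FS is satisfied
at every point of every Kripke model on every Int2GC+FS-frame. -/
theorem int2gcfs_kripke_sound (A : Fm) (h : Prov FSAx A) :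
    ∀ (X : Type) [Preorder X] (R : X → X → Prop),
      (∀ x y z : X, R x y → y ≤ z → ∃ w, x ≤ w ∧ R w z) →
      (∀ x y z : X, y ≤ x → R y z → ∃ w, R x w ∧ z ≤ w) →
      ∀ v : ℕ → Set X, (∀ n, IsUpperSet (v n)) →
      ∀ x : X, SatFS R v x A := by
  intro X _ R h₁ h₂ v hv
  induction h with
  | intAx hA => exact hA.satFS (SatFS.mono h₁ h₂ hv)
  | extra hA => exact FSAx.satFS h₁ h₂ hA
  | mp _ _ ihAB ihA => exact fun x => ihAB x x le_rfl (ihA x)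
  | gc1 _ ih => exact fun _ y _ ⟨u, hyu, hu⟩ => ih u u le_rfl hu y hyu
  | gc2 _ ih => exact fun _ y _ hA u huy => ih u u le_rfl ⟨y, huy, hA⟩
  | gc3 _ ih => exact fun _ y _ ⟨u, huy, hu⟩ => ih u u le_rfl hu y huy
  | gc4 _ ih => exact fun _ y _ hA u hyu => ih u u le_rfl ⟨y, hyu, hA⟩
end

section
/- Kripke completeness of Int2GC: a formula A is provable in Int2GC if and only if A is satisfied at every point of every Kripke model on every Int2GC-frame. -/
/-- Satisfaction in a Kripke model on an Int2GC-frame `(X, ≤, R₁, R₂)` with valuation `v`. -/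
def Sat2 {X : Type*} [Preorder X] (R1 R2 : X → X → Prop) (v : ℕ → Set X) : X → Fm → Prop
  | x, .var n => x ∈ v n
  | x, .and A B => Sat2 R1 R2 v x A ∧ Sat2 R1 R2 v x B
  | x, .or A B => Sat2 R1 R2 v x A ∨ Sat2 R1 R2 v x B
  | x, .imp A B => ∀ y, x ≤ y → Sat2 R1 R2 v y A → Sat2 R1 R2 v y B
  | x, .neg A => ∀ y, x ≤ y → ¬ Sat2 R1 R2 v y A
  | x, .dia1 A => ∃ y, R1 x y ∧ Sat2 R1 R2 v y A
  | x, .box1 A => ∀ y, R1 y x → Sat2 R1 R2 v y A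
  | x, .dia2 A => ∃ y, R2 y x ∧ Sat2 R1 R2 v y A
  | x, .box2 A => ∀ y, R2 x y → Sat2 R1 R2 v y A

/-- A theory over `Ax`: a set of formulas containing all provable formulas and closed under
modus ponens. -/
structure IsTheory (Ax : Fm → Prop) (T : Set Fm) : Prop where
  prov : ∀ {A}, Prov Ax A → A ∈ T
  mp : ∀ {A B}, Fm.imp A B ∈ T → A ∈ T → B ∈ T

/-- A prime theory: a proper theory with the disjunction property. -/
structure IsPrimeTheory (Ax : Fm → Prop) (T : Set Fm) : Prop extends IsTheory Ax T where
  proper : ∃ A, A ∉ T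
  prime : ∀ {A B}, Fm.or A B ∈ T → A ∈ T ∨ B ∈ T

theorem isTheory_prov (Ax : Fm → Prop) : IsTheory Ax {A | Prov Ax A} :=
  ⟨fun h => h, fun h h' => .mp h h'⟩

namespace IsTheory

variable {Ax : Fm → Prop} {T : Set Fm} {A B C : Fm}

theorem intAx (hT : IsTheory Ax T) (h : IntAx A) : A ∈ T := hT.prov (.intAx h)

theorem imp_of_mem (hT : IsTheory Ax T) (h : B ∈ T) : Fm.imp A B ∈ T :=
  hT.mp (hT.intAx (.a1 B A)) h

theorem imp_self (hT : IsTheory Ax T) (A : Fm) : Fm.imp A A ∈ T :=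
  hT.mp (hT.mp (hT.intAx (.a2 A (.imp A A) A)) (hT.intAx (.a1 A (.imp A A))))
    (hT.intAx (.a1 A A))

/-- The deduction theorem: the formulas implied by `A` modulo a theory form a theory. -/
theorem adjoin (hT : IsTheory Ax T) (A : Fm) : IsTheory Ax {B | Fm.imp A B ∈ T} :=
  ⟨fun h => hT.imp_of_mem (hT.prov h), fun h h' => hT.mp (hT.mp (hT.intAx (.a2 A _ _)) h) h'⟩

theorem imp_trans (hT : IsTheory Ax T) (h : Fm.imp A B ∈ T) (h' : Fm.imp B C ∈ T) :
    Fm.imp A C ∈ T :=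
  (hT.adjoin A).mp (hT.imp_of_mem h') h

theorem or_imp (hT : IsTheory Ax T) (h : Fm.imp A C ∈ T) (h' : Fm.imp B C ∈ T) :
    Fm.imp (.or A B) C ∈ T :=
  hT.mp (hT.mp (hT.intAx (.a8 A B C)) h) h'

theorem and_mem (hT : IsTheory Ax T) : Fm.and A B ∈ T ↔ A ∈ T ∧ B ∈ T :=
  ⟨fun h => ⟨hT.mp (hT.intAx (.a3 A B)) h, hT.mp (hT.intAx (.a4 A B)) h⟩,
    fun h => hT.mp (hT.mp (hT.intAx (.a5 A B)) h.1) h.2⟩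

/-- A theory disjoint from a nonempty set closed under disjunction extends to a prime theory
disjoint from that set. -/
theorem exists_prime_disjoint (hT : IsTheory Ax T) {I : Set Fm} (hne : I.Nonempty)
    (hor : ∀ A ∈ I, ∀ B ∈ I, Fm.or A B ∈ I) (hd : ∀ A ∈ T, A ∉ I) :
    ∃ P, IsPrimeTheory Ax P ∧ T ⊆ P ∧ ∀ A ∈ P, A ∉ I := by
  obtain ⟨P, hTP, ⟨hP, hPd⟩, hmax⟩ :=
      zorn_subset_nonempty {S | IsTheory Ax S ∧ ∀ A ∈ S, A ∉ I} (by
    intro c hc hchain hcne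
    refine ⟨⋃₀ c, ⟨⟨?_, ?_⟩, ?_⟩, fun s hs => Set.subset_sUnion_of_mem hs⟩
    · intro A hA
      obtain ⟨s, hs⟩ := hcne
      exact ⟨s, hs, (hc hs).1.prov hA⟩
    · rintro A B ⟨s, hs, hAs⟩ ⟨t, ht, hAt⟩
      rcases hchain.total hs ht with h | h
      · exact ⟨t, ht, (hc ht).1.mp (h hAs) hAt⟩
      · exact ⟨s, hs, (hc hs).1.mp hAs (h hAt)⟩
    · rintro A ⟨s, hs, hA⟩
      exact (hc hs).2 A hA) T ⟨hT, hd⟩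
  have key : ∀ A, A ∉ P → ∃ C ∈ I, Fm.imp A C ∈ P := by
    intro A hA
    by_contra! hcon
    exact hA (hmax ⟨hP.adjoin A, fun C hC hI => hcon C hI hC⟩
      (fun _ h => hP.imp_of_mem h) (hP.imp_self A))
  refine ⟨P, ⟨hP, ?_, ?_⟩, hTP, hPd⟩
  · obtain ⟨A, hA⟩ := hne
    exact ⟨A, fun h => hPd A h hA⟩
  · intro A B hAB
    by_contra! hcon
    obtain ⟨C, hC, hAC⟩ := key A hcon.1
    obtain ⟨D, hD, hBD⟩ := key B hcon.2
    exact hPd _ (hP.mp (hP.or_imp (hP.imp_trans hAC (hP.intAx (.a6 C D)))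
      (hP.imp_trans hBD (hP.intAx (.a7 C D)))) hAB) (hor C hC D hD)

theorem exists_prime_notMem (hT : IsTheory Ax T) (hA : A ∉ T) :
    ∃ P, IsPrimeTheory Ax P ∧ T ⊆ P ∧ A ∉ P := by
  have hp := isTheory_prov Ax
  obtain ⟨P, hP, hTP, hd⟩ := hT.exists_prime_disjoint (I := {C | Prov Ax (.imp C A)})
    ⟨A, hp.imp_self A⟩ (fun _ h _ h' => hp.or_imp h h')
    (fun C hC h => hA (hT.mp (hT.prov h) hC))
  exact ⟨P, hP, hTP, fun h => hd A h (hp.imp_self A)⟩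

end IsTheory

/-- The unary connectives `d` and `b` form a Galois connection with respect to provable
implication, `d` being the lower adjoint. -/
def ProvGC (Ax : Fm → Prop) (d b : Fm → Fm) : Prop :=
  ∀ A B, Prov Ax (.imp (d A) B) ↔ Prov Ax (.imp A (b B))

theorem provGC_dia1_box1 (Ax : Fm → Prop) : ProvGC Ax .dia1 .box1 := fun _ _ => ⟨.gc2, .gc1⟩

theorem provGC_dia2_box2 (Ax : Fm → Prop) : ProvGC Ax .dia2 .box2 := fun _ _ => ⟨.gc4, .gc3⟩

namespace ProvGC

variable {Ax : Fm → Prop} {d b : Fm → Fm} {x y : Set Fm} {A B : Fm}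

theorem imp_box_dia (h : ProvGC Ax d b) (A : Fm) : Prov Ax (.imp A (b (d A))) :=
  (h _ _).1 ((isTheory_prov Ax).imp_self _)

theorem dia_box_imp (h : ProvGC Ax d b) (A : Fm) : Prov Ax (.imp (d (b A)) A) :=
  (h _ _).2 ((isTheory_prov Ax).imp_self _)

theorem dia_mono (h : ProvGC Ax d b) (hAB : Prov Ax (.imp A B)) : Prov Ax (.imp (d A) (d B)) :=
  (h _ _).2 ((isTheory_prov Ax).imp_trans hAB (h.imp_box_dia B))

theorem dia_or (h : ProvGC Ax d b) (A B : Fm) :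
    Prov Ax (.imp (d (.or A B)) (.or (d A) (d B))) :=
  (h _ _).2 ((isTheory_prov Ax).or_imp ((h _ _).1 (.intAx (.a6 _ _)))
    ((h _ _).1 (.intAx (.a7 _ _))))

theorem isTheory_box (h : ProvGC Ax d b) (hx : IsTheory Ax x) : IsTheory Ax {B | b B ∈ x} := by
  have hp := isTheory_prov Ax
  refine ⟨fun {A} hA => hx.mp (hx.prov ((h _ _).1 (hp.imp_of_mem hA))) (hx.prov hA), ?_⟩
  intro A B hAB hA
  have hmp : Prov Ax (.imp (d (.and (b (.imp A B)) (b A))) B) :=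
    (hp.adjoin _).mp
      (hp.imp_trans (h.dia_mono (.intAx (.a3 _ _))) (h.dia_box_imp (.imp A B)))
      (hp.imp_trans (h.dia_mono (.intAx (.a4 _ _))) (h.dia_box_imp A))
  exact hx.mp (hx.prov ((h _ _).1 hmp)) (hx.and_mem.2 ⟨hAB, hA⟩)

/-- The canonical accessibility relation has equivalent descriptions through `d` and `b`. -/
theorem dia_mem_iff_box_mem (h : ProvGC Ax d b) (hx : IsTheory Ax x) (hy : IsTheory Ax y) :
    (∀ A ∈ y, d A ∈ x) ↔ ∀ A, b A ∈ y → A ∈ x :=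
  ⟨fun H A hA => hx.mp (hx.prov (h.dia_box_imp A)) (H _ hA),
    fun H A hA => H _ (hy.mp (hy.prov (h.imp_box_dia A)) hA)⟩

theorem dia_mem_iff (h : ProvGC Ax d b) (hx : IsPrimeTheory Ax x) :
    d A ∈ x ↔ ∃ y, IsPrimeTheory Ax y ∧ (∀ B ∈ y, d B ∈ x) ∧ A ∈ y := by
  refine ⟨fun hA => ?_, fun ⟨y, _, hyx, hA⟩ => hyx A hA⟩
  have hp := isTheory_prov Ax
  obtain ⟨y, hy, hAy, hyI⟩ := (hp.adjoin A).exists_prime_disjoint (I := {B | d B ∉ x})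
    (by
      obtain ⟨D, hD⟩ := hx.proper
      exact ⟨b D, fun H => hD (hx.mp (hx.prov (h.dia_box_imp D)) H)⟩)
    (fun B hB C hC H => (hx.prime (hx.mp (hx.prov (h.dia_or B C)) H)).elim hB hC)
    (fun B hB H => H (hx.mp (hx.prov (h.dia_mono hB)) hA))
  exact ⟨y, hy, fun B hB => not_not.1 (hyI B hB), hAy (hp.imp_self A)⟩

theorem box_mem_iff (h : ProvGC Ax d b) (hx : IsTheory Ax x) :
    b A ∈ x ↔ ∀ y, IsPrimeTheory Ax y → (∀ B ∈ x, d B ∈ y) → A ∈ y := by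
  refine ⟨fun hA y hy H => (h.dia_mem_iff_box_mem hy.toIsTheory hx).1 H A hA, fun H => ?_⟩
  by_contra hA
  obtain ⟨y, hy, hxy, hAy⟩ := (h.isTheory_box hx).exists_prime_notMem hA
  exact hAy (H y hy ((h.dia_mem_iff_box_mem hy.toIsTheory hx).2 fun B hB => hxy hB))

end ProvGC

namespace IsPrimeTheory

variable {Ax : Fm → Prop} {x : Set Fm} {A B : Fm}

theorem imp_mem_iff (hx : IsPrimeTheory Ax x) :
    Fm.imp A B ∈ x ↔ ∀ y, IsPrimeTheory Ax y → x ⊆ y → A ∈ y → B ∈ y := by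
  refine ⟨fun h y hy hxy hA => hy.mp (hxy h) hA, fun H => ?_⟩
  by_contra hAB
  obtain ⟨y, hy, hxy, hB⟩ := (hx.adjoin A).exists_prime_notMem hAB
  exact hB (H y hy (fun _ h => hxy (hx.imp_of_mem h)) (hxy (hx.imp_self A)))

theorem neg_mem_iff (hx : IsPrimeTheory Ax x) :
    Fm.neg A ∈ x ↔ ∀ y, IsPrimeTheory Ax y → x ⊆ y → A ∉ y := by
  constructor
  · intro h y hy hxy hA
    obtain ⟨D, hD⟩ := hy.proper
    exact hD (hy.mp (hy.mp (hy.intAx (.a10 A D)) (hxy h)) hA)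
  · intro H
    have himp : Fm.imp A (.neg A) ∈ x :=
      hx.imp_mem_iff.2 fun y hy hxy hA => (H y hy hxy hA).elim
    exact hx.mp (hx.mp (hx.intAx (.a9 A A)) (hx.imp_self A)) himp

end IsPrimeTheory

/-- The points of the canonical model, ordered by inclusion. -/
abbrev PrimeTheory (Ax : Fm → Prop) : Type := {x : Set Fm // IsPrimeTheory Ax x}

/-- The truth lemma for the canonical model. -/
theorem sat2_primeTheory_iff (Ax : Fm → Prop) (A : Fm) (x : PrimeTheory Ax) :
    Sat2 (fun x y : PrimeTheory Ax => ∀ B ∈ y.1, Fm.dia1 B ∈ x.1)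
      (fun x y : PrimeTheory Ax => ∀ B ∈ x.1, Fm.dia2 B ∈ y.1)
      (fun n => {x | Fm.var n ∈ x.1}) x A ↔ A ∈ x.1 := by
  induction A generalizing x with
  | var n => exact Iff.rfl
  | and A B ihA ihB => simp only [Sat2, ihA, ihB, x.2.and_mem]
  | or A B ihA ihB =>
    simp only [Sat2, ihA, ihB]
    exact ⟨fun h => h.elim (x.2.mp (x.2.intAx (.a6 A B))) (x.2.mp (x.2.intAx (.a7 A B))),
      x.2.prime⟩
  | imp A B ihA ihB =>
    simp only [Sat2, ihA, ihB, x.2.imp_mem_iff]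
    exact ⟨fun H y hy hxy => H ⟨y, hy⟩ hxy, fun H y hxy => H y.1 y.2 hxy⟩
  | neg A ih =>
    simp only [Sat2, ih, x.2.neg_mem_iff]
    exact ⟨fun H y hy hxy => H ⟨y, hy⟩ hxy, fun H y hxy => H y.1 y.2 hxy⟩
  | dia1 A ih =>
    rw [(provGC_dia1_box1 Ax).dia_mem_iff x.2]
    simp only [Sat2, ih]
    exact ⟨fun ⟨y, h⟩ => ⟨y.1, y.2, h⟩, fun ⟨y, hy, h⟩ => ⟨⟨y, hy⟩, h⟩⟩
  | box1 A ih =>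
    simp only [Sat2, ih, (provGC_dia1_box1 Ax).box_mem_iff x.2.toIsTheory]
    exact ⟨fun H y hy => H ⟨y, hy⟩, fun H y => H y.1 y.2⟩
  | dia2 A ih =>
    rw [(provGC_dia2_box2 Ax).dia_mem_iff x.2]
    simp only [Sat2, ih]
    exact ⟨fun ⟨y, h⟩ => ⟨y.1, y.2, h⟩, fun ⟨y, hy, h⟩ => ⟨⟨y, hy⟩, h⟩⟩
  | box2 A ih =>
    simp only [Sat2, ih, (provGC_dia2_box2 Ax).box_mem_iff x.2.toIsTheory]
    exact ⟨fun H y hy => H ⟨y, hy⟩, fun H y => H y.1 y.2⟩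

section Soundness

variable {X : Type*} [Preorder X] {R1 R2 : X → X → Prop} {v : ℕ → Set X} {A : Fm} {x y : X}

/-- Satisfaction is persistent along the preorder. -/
theorem Sat2.mono (h1 : ∀ x u w y : X, u ≤ x → R1 u w → y ≤ w → R1 x y)
    (h2 : ∀ x u w y : X, x ≤ u → R2 u w → w ≤ y → R2 x y) (hv : ∀ n, IsUpperSet (v n))
    (hxy : x ≤ y) (h : Sat2 R1 R2 v x A) : Sat2 R1 R2 v y A := by
  induction A generalizing x y with
  | var n => exact hv n hxy h
  | and A B ihA ihB => exact ⟨ihA hxy h.1, ihB hxy h.2⟩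
  | or A B ihA ihB => exact h.imp (ihA hxy) (ihB hxy)
  | imp A B => exact fun z hz => h z (hxy.trans hz)
  | neg A => exact fun z hz => h z (hxy.trans hz)
  | dia1 A => exact let ⟨z, hz, hA⟩ := h; ⟨z, h1 _ _ _ _ hxy hz le_rfl, hA⟩
  | box1 A => exact fun z hz => h z (h1 _ _ _ _ le_rfl hz hxy)
  | dia2 A => exact let ⟨z, hz, hA⟩ := h; ⟨z, h2 _ _ _ _ le_rfl hz hxy, hA⟩
  | box2 A => exact fun z hz => h z (h2 _ _ _ _ hxy hz le_rfl)

theorem IntAx.sat2 (h1 : ∀ x u w y : X, u ≤ x → R1 u w → y ≤ w → R1 x y)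
    (h2 : ∀ x u w y : X, x ≤ u → R2 u w → w ≤ y → R2 x y) (hv : ∀ n, IsUpperSet (v n))
    (h : IntAx A) (x : X) : Sat2 R1 R2 v x A := by
  cases h with
  | a1 A B => exact fun y _ hA z hz _ => hA.mono h1 h2 hv hz
  | a2 A B C =>
    exact fun y _ hABC z hz hAB w hw hA => hABC w (hz.trans hw) hA w le_rfl (hAB w hw hA)
  | a3 A B => exact fun y _ h => h.1
  | a4 A B => exact fun y _ h => h.2
  | a5 A B => exact fun y _ hA z hz hB => ⟨hA.mono h1 h2 hv hz, hB⟩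
  | a6 A B => exact fun y _ h => Or.inl h
  | a7 A B => exact fun y _ h => Or.inr h
  | a8 A B C =>
    exact fun y _ hA z hz hB w hw h => h.elim (hA w (hz.trans hw)) (hB w hw)
  | a9 A B =>
    exact fun y _ hB z hz hnB w hw hA => hnB w hw hA w le_rfl (hB w (hz.trans hw) hA)
  | a10 A B => exact fun y _ hn z hz hA => (hn z hz hA).elim

theorem Prov.sat2 {Ax : Fm → Prop} (h1 : ∀ x u w y : X, u ≤ x → R1 u w → y ≤ w → R1 x y)
    (h2 : ∀ x u w y : X, x ≤ u → R2 u w → w ≤ y → R2 x y) (hv : ∀ n, IsUpperSet (v n))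
    (hAx : ∀ A, Ax A → ∀ x, Sat2 R1 R2 v x A) (h : Prov Ax A) (x : X) :
    Sat2 R1 R2 v x A := by
  induction h generalizing x with
  | intAx h => exact h.sat2 h1 h2 hv x
  | extra h => exact hAx _ h x
  | mp _ _ ihAB ihA => exact ihAB x x le_rfl (ihA x)
  | gc1 _ ih => exact fun y _ ⟨z, hyz, hA⟩ => ih z z le_rfl hA y hyz
  | gc2 _ ih => exact fun y _ hA z hzy => ih z z le_rfl ⟨y, hzy, hA⟩
  | gc3 _ ih => exact fun y _ ⟨z, hzy, hA⟩ => ih z z le_rfl hA y hzy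
  | gc4 _ ih => exact fun y _ hA z hyz => ih z z le_rfl ⟨y, hyz, hA⟩

end Soundness

/-- Kripke completeness of Int2GC: a formula is provable in Int2GC iff it is satisfied
at every point of every Kripke model on every Int2GC-frame, i.e. a frame `(X, ≤, R₁, R₂)`
with (R2) `≥ ∘ R₁ ∘ ≥ ⊆ R₁` and (R3) `≤ ∘ R₂ ∘ ≤ ⊆ R₂`. -/
theorem int2gc_kripke_complete (A : Fm) :
    Prov NoAx A ↔
      ∀ (X : Type) [Preorder X] (R1 R2 : X → X → Prop),
        (∀ x u w y : X, u ≤ x → R1 u w → y ≤ w → R1 x y) →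
        (∀ x u w y : X, x ≤ u → R2 u w → w ≤ y → R2 x y) →
        ∀ v : ℕ → Set X, (∀ n, IsUpperSet (v n)) →
        ∀ x : X, Sat2 R1 R2 v x A := by
  refine ⟨fun h X _ R1 R2 h1 h2 v hv => h.sat2 h1 h2 hv fun _ => False.elim, fun H => ?_⟩
  by_contra hA
  obtain ⟨P, hP, -, hAP⟩ := (isTheory_prov NoAx).exists_prime_notMem hA
  refine hAP ((sat2_primeTheory_iff NoAx A ⟨P, hP⟩).1 (H _ _ _ ?_ ?_ _ ?_ _))
  · exact fun x u w y (hux : u.1 ⊆ x.1) huw (hyw : y.1 ⊆ w.1) B hB => hux (huw B (hyw hB))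
  · exact fun x u w y (hxu : x.1 ⊆ u.1) huw (hwy : w.1 ⊆ y.1) B hB => hwy (huw B (hxu hB))
  · exact fun n x y (hxy : x.1 ⊆ y.1) hx => hxy hx
end

section
/- Let H be a Heyting algebra with unary maps f, g, f', g' forming an H2GC+FS-algebra. If k is a filter of H and y is a prime filter of H such that k ∩ {g'(a) | a ∉ y} = ∅, then there exists a prime filter u of H with k ⊆ u and u ∩ {g'(a) | a ∉ y} = ∅. -/
/-- A filter of a lattice: a nonempty, upward-closed subset closed under binary meets. -/
def IsLatFilter {H : Type*} [Lattice H] (F : Set H) : Prop :=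
  F.Nonempty ∧ (∀ a b : H, a ∈ F → a ≤ b → b ∈ F) ∧ (∀ a b : H, a ∈ F → b ∈ F → a ⊓ b ∈ F)

/-- A prime filter: a proper filter `F` such that `a ⊔ b ∈ F` implies `a ∈ F` or `b ∈ F`. -/
def IsPrimeLatFilter {H : Type*} [Lattice H] (F : Set H) : Prop :=
  IsLatFilter F ∧ F ≠ Set.univ ∧ ∀ a b : H, a ⊔ b ∈ F → a ∈ F ∨ b ∈ F

/-- The lower set generated by the image under a monotone map of the complement of a prime
filter, as an order ideal. -/
def IsPrimeLatFilter.idealOfMonotone {H : Type*} [Lattice H] {y : Set H}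
    (hy : IsPrimeLatFilter y) {g : H → H} (hg : Monotone g) : Order.Ideal H where
  carrier := {x | ∃ a ∉ y, x ≤ g a}
  lower' := fun _ _ hba ⟨c, hc, hac⟩ => ⟨c, hc, hba.trans hac⟩
  nonempty' := by
    obtain ⟨a, ha⟩ := (Set.ne_univ_iff_exists_notMem y).1 hy.2.1
    exact ⟨g a, a, ha, le_rfl⟩
  directed' := by
    rintro x ⟨a, ha, hxa⟩ z ⟨b, hb, hzb⟩
    exact ⟨g (a ⊔ b), ⟨a ⊔ b, fun h => (hy.2.2 a b h).elim ha hb, le_rfl⟩,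
      hxa.trans (hg le_sup_left), hzb.trans (hg le_sup_right)⟩

/-- A filter of a lattice, as an order filter. -/
def IsLatFilter.toPFilter {H : Type*} [Lattice H] {k : Set H} (hk : IsLatFilter k) :
    Order.PFilter H :=
  Order.IsPFilter.toPFilter (F := k) <| Order.IsPFilter.of_def hk.1
    (fun a ha b hb => ⟨a ⊓ b, hk.2.2 a b ha hb, inf_le_left, inf_le_right⟩)
    (fun {a b} hab ha => hk.2.1 a b ha hab)

/-- The complement of a prime ideal is a prime filter. -/
theorem Order.Ideal.IsPrime.isPrimeLatFilter_compl {H : Type*} [Lattice H] {J : Order.Ideal H}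
    (hJ : J.IsPrime) : IsPrimeLatFilter (J : Set H)ᶜ := by
  refine ⟨⟨?_, fun a b ha hab hb => ha (J.lower hab hb), fun a b ha hb h =>
    (hJ.mem_or_mem h).elim ha hb⟩, ?_, fun a b h => ?_⟩
  · exact (Set.ne_univ_iff_exists_notMem _).1 hJ.toIsProper.ne_univ
  · exact fun h => J.nonempty.ne_empty (Set.compl_univ_iff.1 h)
  · by_contra! hab
    exact h (Order.Ideal.sup_mem (not_not.1 hab.1) (not_not.1 hab.2))

/-- In an H2GC+FS-algebra, if a filter `k` is disjoint from `{g' a | a ∉ y}` for a prime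
filter `y`, then `k` extends to a prime filter `u` still disjoint from `{g' a | a ∉ y}`. -/
theorem filter_extension_disjoint_from_g'_image {H : Type*} [HeytingAlgebra H]
    (f g f' g' : H → H)
    (hfg : ∀ a b : H, f a ≤ b ↔ a ≤ g b) (hf'g' : ∀ a b : H, f' a ≤ b ↔ a ≤ g' b)
    (hfs1 : ∀ a b : H, f (a ⇨ b) ≤ g' a ⇨ f b) (hfs2 : ∀ a b : H, f' (a ⇨ b) ≤ g a ⇨ f' b)
    (k : Set H) (hk : IsLatFilter k) (y : Set H) (hy : IsPrimeLatFilter y)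
    (hdisj : k ∩ (g' '' yᶜ) = ∅) :
    ∃ u : Set H, IsPrimeLatFilter u ∧ k ⊆ u ∧ u ∩ (g' '' yᶜ) = ∅ := by
  have gc : GaloisConnection f' g' := hf'g'
  let I := hy.idealOfMonotone gc.monotone_u
  have hkI : Disjoint (hk.toPFilter : Set H) (I : Set H) := by
    refine Set.disjoint_left.2 ?_
    rintro x hx ⟨a, ha, hxa⟩
    exact Set.eq_empty_iff_forall_notMem.1 hdisj (g' a)
      ⟨hk.2.1 x (g' a) hx hxa, Set.mem_image_of_mem g' ha⟩
  obtain ⟨J, hJ, hIJ, hkJ⟩ := DistribLattice.prime_ideal_of_disjoint_filter_ideal hkI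
  refine ⟨(J : Set H)ᶜ, hJ.isPrimeLatFilter_compl, fun x hx => Set.disjoint_left.1 hkJ hx, ?_⟩
  refine Set.eq_empty_iff_forall_notMem.2 ?_
  rintro _ ⟨hJa, a, ha, rfl⟩
  exact hJa (hIJ ⟨a, ha, le_rfl⟩)
end
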